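/- Let f_1, …, f_T : ℝ^d → ℝ be differentiable functions, each convex on K and α-smooth on K, and for each t let x_t⋆ ∈ K be a minimizer of f_t over K. Let x_1 ∈ K and, for each t = 1, …, T−1, let x_{t+1} ∈ K be a Euclidean projection onto K of x_t − (1/α)∇f_t(x_t), i.e., ‖x_{t+1} − (x_t − (1/α)∇f_t(x_t))‖ ≤ ‖u − (x_t − (1/α)∇f_t(x_t))‖ for all u ∈ K (online gradient descent with step size 1/α). Let M satisfy 2|f_t(u)| ≤ M for all t and all u ∈ K, let δ_2, …, δ_T be reals with |f_t(u) − f_{t−1}(u)| ≤ δ_t for all u ∈ K, and set V_T = Σ_{t=2}^T δ_t. Then Σ_{t=1}^{T−1} (f_t(x_{t+1}) − f_t(x_t⋆))² ≤ 2αD²(M + V_T). -/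

import Mathlib

open RealInnerProductSpace Finset

/-- First-order lower bound for a convex function that is differentiable at the base point. -/
lemma ConvexOn.add_inner_gradient_le {E : Type*} [NormedAddCommGroup E] [InnerProductSpace ℝ E]
    [CompleteSpace E] {K : Set E} {f : E → ℝ} (hf : ConvexOn ℝ K f) {x u : E}
    (hx : x ∈ K) (hu : u ∈ K) (hd : DifferentiableAt ℝ f x) :
    f x + ⟪gradient f x, u - x⟫ ≤ f u := by
  have hline : HasDerivAt (f ∘ AffineMap.lineMap (k := ℝ) x u) ⟪gradient f x, u - x⟫ 0 := by
    have h := hd.hasGradientAt.hasFDerivAt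
    rw [← AffineMap.lineMap_apply_zero (k := ℝ) x u] at h
    simpa using h.comp_hasDerivAt (0 : ℝ) AffineMap.hasDerivAt_lineMap
  have h := (hf.comp_affineMap (AffineMap.lineMap (k := ℝ) x u)).le_slope_of_hasDerivAt
    (x := 0) (y := 1) (by simpa using hx) (by simpa using hu) one_pos hline
  simp only [slope_def_field, Function.comp_apply, AffineMap.lineMap_apply_zero,
    AffineMap.lineMap_apply_one, sub_zero, div_one] at h
  linarith

/-- Variational inequality for a nearest point of a convex set. -/
lemma Convex.inner_sub_le_zero_of_forall_norm_sub_le {E : Type*} [NormedAddCommGroup E]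
    [InnerProductSpace ℝ E] {K : Set E} (hK : Convex ℝ K) {y z : E} (hy : y ∈ K)
    (hmin : ∀ u ∈ K, ‖y - z‖ ≤ ‖u - z‖) {u : E} (hu : u ∈ K) : ⟪z - y, u - y⟫ ≤ 0 := by
  refine (norm_eq_iInf_iff_real_inner_le_zero hK hy).1 ?_ u hu
  have : Nonempty K := ⟨⟨y, hy⟩⟩
  refine le_antisymm (le_ciInf fun w => ?_)
    (ciInf_le (f := fun w : K => ‖z - w‖) ⟨0, ?_⟩ ⟨y, hy⟩)
  · simpa [norm_sub_rev] using hmin w w.2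
  · rintro _ ⟨w, rfl⟩
    exact norm_nonneg _

/-- A projected gradient step with step size `1 / α` for a convex `α`-smooth function: the squared
gap after the step is controlled by the decrease of the function value. -/
lemma sq_gap_le_of_projected_gradient_step {E : Type*} [NormedAddCommGroup E]
    [InnerProductSpace ℝ E] [CompleteSpace E] {K : Set E} {f : E → ℝ} (hf : ConvexOn ℝ K f)
    {D α : ℝ} (hα : 0 < α) {x y p : E} (hx : x ∈ K) (hy : y ∈ K) (hp : p ∈ K)
    (hd : DifferentiableAt ℝ f x)
    (hsmooth : f y ≤ f x + ⟪gradient f x, y - x⟫ + α / 2 * ‖x - y‖ ^ 2)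
    (hproj : ∀ u ∈ K, ‖y - (x - (1 / α) • gradient f x)‖ ≤ ‖u - (x - (1 / α) • gradient f x)‖)
    (hmin : f p ≤ f y) (hxp : ‖x - p‖ ≤ D) (hyp : ‖y - p‖ ≤ D) :
    (f y - f p) ^ 2 ≤ 2 * α * D ^ 2 * (f x - f y) := by
  have key : ∀ u ∈ K, f y - f u ≤ α * ⟪x - y, y - u⟫ + α / 2 * ‖x - y‖ ^ 2 := by
    intro u hu
    have hconv := hf.add_inner_gradient_le hx hu hd
    have hvar := hf.1.inner_sub_le_zero_of_forall_norm_sub_le hy hproj hu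
    have hsplit : α * ⟪x - (1 / α) • gradient f x - y, u - y⟫
        = -(α * ⟪x - y, y - u⟫) + ⟪gradient f x, y - x⟫ - ⟪gradient f x, u - x⟫ := by
      simp only [inner_sub_left, inner_sub_right, real_inner_smul_left]
      field_simp
      ring
    have := mul_nonpos_of_nonneg_of_nonpos hα.le hvar
    linarith
  have hdescent : α / 2 * ‖x - y‖ ^ 2 ≤ f x - f y := by
    have h := key x hx
    rw [← neg_sub x y, inner_neg_right, real_inner_self_eq_norm_sq] at h
    linarith
  have hgap : f y - f p ≤ α * D * ‖x - y‖ := by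
    have hid : α * ⟪x - y, y - p⟫ + α / 2 * ‖x - y‖ ^ 2
        = α / 2 * ⟪x - y, (x - p) + (y - p)⟫ := by
      rw [← real_inner_self_eq_norm_sq]
      simp only [inner_sub_left, inner_sub_right, inner_add_right]
      ring
    have hcs : ⟪x - y, (x - p) + (y - p)⟫ ≤ ‖x - y‖ * (D + D) :=
      (real_inner_le_norm _ _).trans <| mul_le_mul_of_nonneg_left
        ((norm_add_le _ _).trans (add_le_add hxp hyp)) (norm_nonneg _)
    have := mul_le_mul_of_nonneg_left hcs (half_pos hα).le
    linarith [key p hp]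
  calc (f y - f p) ^ 2 ≤ (α * D * ‖x - y‖) ^ 2 := pow_le_pow_left₀ (sub_nonneg.2 hmin) hgap 2
    _ = 2 * α * D ^ 2 * (α / 2 * ‖x - y‖ ^ 2) := by ring
    _ ≤ 2 * α * D ^ 2 * (f x - f y) := by gcongr

/-- Telescoping with drift: the decreases of `f t` from `x t` to `x (t + 1)` sum to at most the
total decrease plus the total variation of the functions along the sequence. -/
lemma sum_decrease_le_add_sum_variation {X : Type*} {f : ℕ → X → ℝ} {x : ℕ → X} {δ : ℕ → ℝ} (n : ℕ)
    (hδ : ∀ t ∈ Finset.Icc 2 (n + 1), f t (x t) - f (t - 1) (x t) ≤ δ t) :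
    ∑ t ∈ Finset.Icc 1 n, (f t (x t) - f t (x (t + 1))) ≤
      f 1 (x 1) - f (n + 1) (x (n + 1)) + ∑ t ∈ Finset.Icc 2 (n + 1), δ t := by
  induction n with
  | zero => simp
  | succ n ih =>
    rw [Finset.sum_Icc_succ_top (by lia), Finset.sum_Icc_succ_top (by lia)]
    have h := hδ (n + 1 + 1) (Finset.mem_Icc.2 ⟨by lia, le_rfl⟩)
    have := ih fun t ht => hδ t (Finset.Icc_subset_Icc_right (by lia) ht)
    rw [Nat.add_sub_cancel] at h
    linarith

/-- sum of squared per-round gaps of OGD with step size 1/α. -/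
theorem ogd_sum_sq_gaps_bound
    {d T : ℕ} (hT : 1 ≤ T) {K : Set (EuclideanSpace ℝ (Fin d))}
    (hKne : K.Nonempty) (hKclosed : IsClosed K) (hKconv : Convex ℝ K)
    {D : ℝ} (hD : 0 < D) (hdiam : ∀ x ∈ K, ∀ y ∈ K, ‖x - y‖ ≤ D)
    {α : ℝ} (hα : 0 < α)
    {f : ℕ → EuclideanSpace ℝ (Fin d) → ℝ}
    (hfdiff : ∀ t ∈ Finset.Icc 1 T, Differentiable ℝ (f t))
    (hfconv : ∀ t ∈ Finset.Icc 1 T, ConvexOn ℝ K (f t))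
    (hfsmooth : ∀ t ∈ Finset.Icc 1 T, ∀ x ∈ K, ∀ y ∈ K,
      f t y ≤ f t x + ⟪gradient (f t) x, y - x⟫ + α / 2 * ‖x - y‖ ^ 2)
    {xstar : ℕ → EuclideanSpace ℝ (Fin d)}
    (hxstarK : ∀ t ∈ Finset.Icc 1 T, xstar t ∈ K)
    (hxstar : ∀ t ∈ Finset.Icc 1 T, ∀ u ∈ K, f t (xstar t) ≤ f t u)
    {x : ℕ → EuclideanSpace ℝ (Fin d)} (hx1 : x 1 ∈ K)
    (hxK : ∀ t ∈ Finset.Icc 1 (T - 1), x (t + 1) ∈ K)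
    (hproj : ∀ t ∈ Finset.Icc 1 (T - 1), ∀ u ∈ K,
      ‖x (t + 1) - (x t - (1 / α) • gradient (f t) (x t))‖ ≤
        ‖u - (x t - (1 / α) • gradient (f t) (x t))‖)
    {M : ℝ} (hMbound : ∀ t ∈ Finset.Icc 1 T, ∀ u ∈ K, 2 * |f t u| ≤ M)
    {δ : ℕ → ℝ}
    (hδ : ∀ t ∈ Finset.Icc 2 T, ∀ u ∈ K, |f t u - f (t - 1) u| ≤ δ t) :
    ∑ t ∈ Finset.Icc 1 (T - 1), (f t (x (t + 1)) - f t (xstar t)) ^ 2 ≤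
      2 * α * D ^ 2 * (M + ∑ t ∈ Finset.Icc 2 T, δ t) := by
  have hxmem : ∀ t ∈ Finset.Icc 1 T, x t ∈ K := by
    intro t ht
    rw [Finset.mem_Icc] at ht
    obtain rfl | h1 := ht.1.eq_or_lt
    · exact hx1
    · obtain ⟨s, rfl⟩ : ∃ s, t = s + 1 := ⟨t - 1, by lia⟩
      exact hxK s (Finset.mem_Icc.2 (by lia))
  have hround : ∀ t ∈ Finset.Icc 1 (T - 1), (f t (x (t + 1)) - f t (xstar t)) ^ 2 ≤
      2 * α * D ^ 2 * (f t (x t) - f t (x (t + 1))) := by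
    intro t ht
    have ht' := Finset.Icc_subset_Icc_right (Nat.sub_le T 1) ht
    have hx := hxmem t ht'
    have hy := hxK t ht
    have hp := hxstarK t ht'
    exact sq_gap_le_of_projected_gradient_step (hfconv t ht') hα hx hy hp (hfdiff t ht' _)
      (hfsmooth t ht' _ hx _ hy) (hproj t ht) (hxstar t ht' _ hy) (hdiam _ hx _ hp)
      (hdiam _ hy _ hp)
  obtain ⟨n, rfl⟩ : ∃ n, T = n + 1 := ⟨T - 1, by lia⟩
  rw [Nat.add_sub_cancel] at hround ⊢
  have hsum := sum_decrease_le_add_sum_variation (f := f) (x := x) n fun t ht =>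
    (le_abs_self _).trans (hδ t ht _ (hxmem t (Finset.Icc_subset_Icc_left one_le_two ht)))
  have hfirst := hMbound 1 (Finset.mem_Icc.2 ⟨le_rfl, hT⟩) _ hx1
  have hend : n + 1 ∈ Finset.Icc 1 (n + 1) := Finset.mem_Icc.2 ⟨hT, le_rfl⟩
  have hlast := hMbound (n + 1) hend _ (hxmem (n + 1) hend)
  refine (Finset.sum_le_sum hround).trans ?_
  rw [← Finset.mul_sum]
  gcongr
  linarith [le_abs_self (f 1 (x 1)), neg_abs_le (f (n + 1) (x (n + 1)))]
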